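/- arXiv:1104.5589 — 8 statements merged into one kernel-verified Lean document; each statement's English description precedes it below -/
import Mathlib

section
/- Suppose f_0 : A → ℝ satisfies ⟨f_0,h⟩ = Σ_{(i,j)∈A} f_0(i,j)h(i,j) = 0 for every h : A → ℝ with zero line sums with respect to S. Let g : A → {0,1} have the same line sums as f_0 with respect to S, and set D = Σ_{(i,j)∈A} g(i,j). Then Σ_{(i,j)∈A} (g(i,j) − f_0(i,j))² = D − Σ_{(i,j)∈A} f_0(i,j)². -/
/-- `(a,b)` is a direction: coprime entries and `a ≥ 0`. -/
def IsDirection (d : ℤ × ℤ) : Prop := Int.gcd d.1 d.2 = 1 ∧ 0 ≤ d.1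

/-- The line sum of `f : A → ℝ` along the line `a·j = b·i + t` for the direction
`d = (a,b)`, where `A = {0,…,m−1} × {0,…,n−1}`. -/
noncomputable def lineSum (m n : ℕ) (f : Fin m × Fin n → ℝ) (d : ℤ × ℤ) (t : ℤ) : ℝ :=
  ∑ p ∈ Finset.univ.filter
      (fun p : Fin m × Fin n => d.1 * (p.2 : ℤ) = d.2 * (p.1 : ℤ) + t), f p

/-- Theorem 4.1: if `f₀` is orthogonal to all functions with zero line sums w.r.t. `S`,
then every binary solution `g` with the same line sums as `f₀` satisfies
`|g − f₀|² = D − |f₀|²` where `D = Σ g`. -/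
theorem stmt_3 (m n : ℕ) (hm : 0 < m) (hn : 0 < n)
    (S : Finset (ℤ × ℤ)) (hS : S.Nonempty) (hSdir : ∀ d ∈ S, IsDirection d)
    (f0 : Fin m × Fin n → ℝ)
    (horth : ∀ h : Fin m × Fin n → ℝ,
      (∀ d ∈ S, ∀ t : ℤ, lineSum m n h d t = 0) →
      ∑ p : Fin m × Fin n, f0 p * h p = 0)
    (g : Fin m × Fin n → ℝ) (hg01 : ∀ p, g p = 0 ∨ g p = 1)
    (hgl : ∀ d ∈ S, ∀ t : ℤ, lineSum m n g d t = lineSum m n f0 d t)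
    (D : ℝ) (hD : D = ∑ p : Fin m × Fin n, g p) :
    ∑ p : Fin m × Fin n, (g p - f0 p) ^ 2 = D - ∑ p : Fin m × Fin n, (f0 p) ^ 2 := by
  have horth_sub := horth (fun p => g p - f0 p) fun d hd t => by
    have h := hgl d hd t
    simp only [lineSum] at h ⊢
    rw [Finset.sum_sub_distrib, h, sub_self]
  have hsq : ∀ p, (g p - f0 p) ^ 2 = g p - f0 p ^ 2 - 2 * (f0 p * (g p - f0 p)) := fun p => by
    rcases hg01 p with h | h <;> rw [h] <;> ring
  simp only [hsq, Finset.sum_sub_distrib, ← Finset.mul_sum, horth_sub, hD, mul_zero, sub_zero]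
end

section
/- Suppose f_0 : A → ℝ satisfies ⟨f_0,h⟩ = Σ_{(i,j)∈A} f_0(i,j)h(i,j) = 0 for every h : A → ℝ with zero line sums with respect to S. Put D = Σ_{(i,j)∈A} f_0(i,j) and E = Σ_{(i,j)∈A} min(f_0(i,j)², (1 − f_0(i,j))²). If E + Σ_{(i,j)∈A} f_0(i,j)² > D, then there exists no function g : A → {0,1} having the same line sums as f_0 with respect to S. -/
theorem lineSum_sub (m n : ℕ) (f g : Fin m × Fin n → ℝ) (d : ℤ × ℤ) (t : ℤ) :
    lineSum m n (fun p => f p - g p) d t = lineSum m n f d t - lineSum m n g d t :=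
  Finset.sum_sub_distrib _ _

/-- The lines in a fixed direction partition the grid. -/
theorem sum_lineSum (m n : ℕ) (f : Fin m × Fin n → ℝ) (d : ℤ × ℤ) :
    ∑ t ∈ Finset.univ.image
        (fun p : Fin m × Fin n => d.1 * (p.2 : ℤ) - d.2 * (p.1 : ℤ)), lineSum m n f d t =
      ∑ p, f p := by
  rw [← Finset.sum_fiberwise_of_maps_to
    (fun p hp => Finset.mem_image_of_mem
      (fun p : Fin m × Fin n => d.1 * (p.2 : ℤ) - d.2 * (p.1 : ℤ)) hp) f]
  refine Finset.sum_congr rfl fun t _ => Finset.sum_congr ?_ fun _ _ => rfl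
  ext p
  simp [sub_eq_iff_eq_add']

/-- Corollary 4.2 (first part): if `E + |f₀|² > D` then there is no binary solution. -/
theorem stmt_4 (m n : ℕ) (hm : 0 < m) (hn : 0 < n)
    (S : Finset (ℤ × ℤ)) (hS : S.Nonempty) (hSdir : ∀ d ∈ S, IsDirection d)
    (f0 : Fin m × Fin n → ℝ)
    (horth : ∀ h : Fin m × Fin n → ℝ,
      (∀ d ∈ S, ∀ t : ℤ, lineSum m n h d t = 0) →
      ∑ p : Fin m × Fin n, f0 p * h p = 0)
    (D E : ℝ)
    (hD : D = ∑ p : Fin m × Fin n, f0 p)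
    (hE : E = ∑ p : Fin m × Fin n, min ((f0 p) ^ 2) ((1 - f0 p) ^ 2))
    (hgt : E + ∑ p : Fin m × Fin n, (f0 p) ^ 2 > D) :
    ¬ ∃ g : Fin m × Fin n → ℝ, (∀ p, g p = 0 ∨ g p = 1) ∧
      (∀ d ∈ S, ∀ t : ℤ, lineSum m n g d t = lineSum m n f0 d t) := by
  rintro ⟨g, hg, hline⟩
  obtain ⟨d, hd⟩ := hS
  have hsum : ∑ p, g p = D := by
    rw [hD, ← sum_lineSum m n g d, ← sum_lineSum m n f0 d]
    exact Finset.sum_congr rfl fun t _ => hline d hd t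
  have hinner : ∑ p, f0 p * (g p - f0 p) = 0 :=
    horth _ fun d hd t => by rw [lineSum_sub, hline d hd t, sub_self]
  have hdist : E ≤ ∑ p, (g p - (f0 p) ^ 2 - 2 * (f0 p * (g p - f0 p))) := by
    rw [hE]
    refine Finset.sum_le_sum fun p _ => ?_
    rcases hg p with h | h <;> rw [h]
    · exact (min_le_left _ _).trans_eq (by ring)
    · exact (min_le_right _ _).trans_eq (by ring)
  rw [Finset.sum_sub_distrib, Finset.sum_sub_distrib, ← Finset.mul_sum, hsum, hinner] at hdist
  linarith
end

section
/- Suppose f_0 : A → ℝ satisfies ⟨f_0,h⟩ = Σ_{(i,j)∈A} f_0(i,j)h(i,j) = 0 for every h : A → ℝ with zero line sums with respect to S. Put D = Σ_{(i,j)∈A} f_0(i,j) and E = Σ_{(i,j)∈A} min(f_0(i,j)², (1 − f_0(i,j))²). If E + Σ_{(i,j)∈A} f_0(i,j)² = D, then every g : A → {0,1} having the same line sums as f_0 with respect to S is obtained by rounding f_0 pixelwise to a nearest element of {0,1}: (g(i,j) − f_0(i,j))² = min(f_0(i,j)², (1 − f_0(i,j))²) for all (i,j) ∈ A. -/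
theorem sum_eq_of_lineSum_eq {m n : ℕ} {f g : Fin m × Fin n → ℝ} {d : ℤ × ℤ}
    (h : ∀ t, lineSum m n f d t = lineSum m n g d t) : ∑ p, f p = ∑ p, g p := by
  simp only [← sum_lineSum m n _ d, h]

/-- Corollary 4.2 (second part): if `E + |f₀|² = D` then every binary solution is
obtained by rounding each `f₀(i,j)` to a nearest element of `{0,1}`. -/
theorem stmt_5 (m n : ℕ) (hm : 0 < m) (hn : 0 < n)
    (S : Finset (ℤ × ℤ)) (hS : S.Nonempty) (hSdir : ∀ d ∈ S, IsDirection d)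
    (f0 : Fin m × Fin n → ℝ)
    (horth : ∀ h : Fin m × Fin n → ℝ,
      (∀ d ∈ S, ∀ t : ℤ, lineSum m n h d t = 0) →
      ∑ p : Fin m × Fin n, f0 p * h p = 0)
    (D E : ℝ)
    (hD : D = ∑ p : Fin m × Fin n, f0 p)
    (hE : E = ∑ p : Fin m × Fin n, min ((f0 p) ^ 2) ((1 - f0 p) ^ 2))
    (heq : E + ∑ p : Fin m × Fin n, (f0 p) ^ 2 = D) :
    ∀ g : Fin m × Fin n → ℝ, (∀ p, g p = 0 ∨ g p = 1) →
      (∀ d ∈ S, ∀ t : ℤ, lineSum m n g d t = lineSum m n f0 d t) →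
      ∀ p : Fin m × Fin n, (g p - f0 p) ^ 2 = min ((f0 p) ^ 2) ((1 - f0 p) ^ 2) := by
  intro g hg hline
  obtain ⟨d, hd⟩ := hS
  have hsum : ∑ p, g p = D := hD ▸ sum_eq_of_lineSum_eq (hline d hd)
  have hinner : ∑ p, f0 p * (g p - f0 p) = 0 :=
    horth _ fun d hd t => by rw [lineSum_sub, hline d hd t, sub_self]
  have hdist : ∑ p, (g p - f0 p) ^ 2 = E := by
    have hpt : ∀ p, (g p - f0 p) ^ 2 = g p - f0 p ^ 2 - 2 * (f0 p * (g p - f0 p)) := by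
      intro p
      rcases hg p with h | h <;> rw [h] <;> ring
    simp only [hpt, Finset.sum_sub_distrib, ← Finset.mul_sum] at hinner ⊢
    linarith
  have hle : ∀ p ∈ Finset.univ,
      min (f0 p ^ 2) ((1 - f0 p) ^ 2) ≤ (g p - f0 p) ^ 2 := by
    intro p _
    rcases hg p with h | h <;> simp [h]
  intro p
  exact ((Finset.sum_eq_sum_iff_of_le hle).1 (hE.symm.trans hdist.symm) p
    (Finset.mem_univ p)).symm
end

section
/- Let V be a real inner product space, let e_1,…,e_d ∈ V be linearly independent with ‖e_i‖ = l_i, and let t_1,…,t_d ∈ [0,1]. Then there exist ε_1,…,ε_d ∈ {0,1} such that ‖Σ_{i=1}^d (t_i − ε_i) e_i‖ ≤ (1/2)·√(l_1² + l_2² + ⋯ + l_d²). Equivalently, the distance from any point of a d-dimensional parallelepiped with edge lengths l_1,…,l_d to its nearest vertex is at most √(l_1² + ⋯ + l_d²)/2. -/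
theorem exists_zero_or_one_norm_add_sub_smul_sq_le {V : Type*} [NormedAddCommGroup V]
    [InnerProductSpace ℝ V] (v e : V) {t : ℝ} (ht : t ∈ Set.Icc (0 : ℝ) 1) :
    ∃ c : ℝ, (c = 0 ∨ c = 1) ∧ ‖v + (t - c) • e‖ ^ 2 ≤ ‖v‖ ^ 2 + ‖e‖ ^ 2 / 4 := by
  have expand (a : ℝ) : ‖v + a • e‖ ^ 2 = ‖v‖ ^ 2 + 2 * a * inner ℝ v e + a ^ 2 * ‖e‖ ^ 2 := by
    rw [norm_add_sq_real, inner_smul_right, norm_smul, mul_pow, Real.norm_eq_abs, sq_abs]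
    ring
  obtain ⟨h0, h1⟩ := ht
  by_contra! h
  have hc0 := h 0 (Or.inl rfl)
  have hc1 := h 1 (Or.inr rfl)
  rw [expand] at hc0 hc1
  -- Choosing `c = 1` with probability `t` gives expectation `‖v‖ ^ 2 + t * (1 - t) * ‖e‖ ^ 2`.
  have hmean : ‖v‖ ^ 2 + ‖e‖ ^ 2 / 4 < ‖v‖ ^ 2 + t * (1 - t) * ‖e‖ ^ 2 := by
    rcases h0.eq_or_lt with rfl | hpos
    · linarith
    · linarith [mul_lt_mul_of_pos_left hc1 hpos,
        mul_le_mul_of_nonneg_left hc0.le (sub_nonneg.2 h1)]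
  nlinarith [mul_nonneg (sq_nonneg (t - 1 / 2)) (sq_nonneg ‖e‖)]

theorem exists_zero_or_one_norm_sum_sub_smul_sq_le {ι V : Type*} [NormedAddCommGroup V]
    [InnerProductSpace ℝ V] (s : Finset ι) (e : ι → V) {t : ι → ℝ}
    (ht : ∀ i, t i ∈ Set.Icc (0 : ℝ) 1) :
    ∃ ε : ι → ℝ, (∀ i, ε i = 0 ∨ ε i = 1) ∧
      ‖∑ i ∈ s, (t i - ε i) • e i‖ ^ 2 ≤ (∑ i ∈ s, ‖e i‖ ^ 2) / 4 := by
  classical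
  induction s using Finset.induction_on with
  | empty => exact ⟨0, by simp, by simp⟩
  | insert a s ha ih =>
    obtain ⟨ε, hε, hs⟩ := ih
    obtain ⟨c, hc, hle⟩ := exists_zero_or_one_norm_add_sub_smul_sq_le
      (∑ i ∈ s, (t i - ε i) • e i) (e a) (ht a)
    refine ⟨Function.update ε a c, fun i => ?_, ?_⟩
    · rcases eq_or_ne i a with rfl | hi
      · simpa using hc
      · simpa [hi] using hε i
    · have hsum : ∑ i ∈ s, (t i - Function.update ε a c i) • e i =
          ∑ i ∈ s, (t i - ε i) • e i :=
        Finset.sum_congr rfl fun i hi => by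
          rw [Function.update_of_ne (ne_of_mem_of_not_mem hi ha)]
      rw [Finset.sum_insert ha, Finset.sum_insert ha, hsum, Function.update_self, add_comm]
      linarith

/-- Lemma 5.2: in a `d`-dimensional parallelepiped with edge lengths `l₁,…,l_d`, every
point is within distance `√(l₁² + ⋯ + l_d²)/2` of some vertex. -/
theorem stmt_9 (V : Type*) [NormedAddCommGroup V] [InnerProductSpace ℝ V]
    (d : ℕ) (e : Fin d → V) (hind : LinearIndependent ℝ e)
    (l : Fin d → ℝ) (hl : ∀ i, ‖e i‖ = l i)
    (t : Fin d → ℝ) (ht : ∀ i, t i ∈ Set.Icc (0 : ℝ) 1) :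
    ∃ ε : Fin d → ℝ, (∀ i, ε i = 0 ∨ ε i = 1) ∧
      ‖∑ i, (t i - ε i) • e i‖ ≤ (1 / 2) * Real.sqrt (∑ i, (l i) ^ 2) := by
  obtain ⟨ε, hε, h⟩ := exists_zero_or_one_norm_sum_sub_smul_sq_le Finset.univ e ht
  refine ⟨ε, hε, ?_⟩
  simp only [hl] at h
  refine (sq_le_sq₀ (norm_nonneg _) (by positivity)).1 ?_
  rw [mul_pow, Real.sq_sqrt (Finset.sum_nonneg fun i _ => sq_nonneg (l i))]
  linarith
end

section
/- Let S be a valid set of directions for A and let g : A → ℝ be a function all of whose line sums along lines with directions in S are integers. Then there exists a function f : A → ℤ having the same line sums as g with respect to S. -/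
/-- The linear form on `ℤ × ℤ` whose level sets are the lines in direction `d`. -/
def lineForm (d : ℤ × ℤ) : ℤ × ℤ →+ ℤ where
  toFun p := d.1 * p.2 - d.2 * p.1
  map_zero' := by simp
  map_add' p q := by simp only [Prod.fst_add, Prod.snd_add]; ring

theorem lineForm_apply (d p : ℤ × ℤ) : lineForm d p = d.1 * p.2 - d.2 * p.1 := rfl

theorem lineForm_self (d : ℤ × ℤ) : lineForm d d = 0 := by
  rw [lineForm_apply]; ring

theorem exists_zsmul_of_lineForm_eq_zero {d p : ℤ × ℤ} (hd : Int.gcd d.1 d.2 = 1)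
    (h : lineForm d p = 0) : ∃ k : ℤ, p = k • d := by
  rw [lineForm_apply] at h
  have hb : d.1 * Int.gcdA d.1 d.2 + d.2 * Int.gcdB d.1 d.2 = 1 := by
    rw [← Int.gcd_eq_gcd_ab, hd]; rfl
  refine ⟨p.1 * Int.gcdA d.1 d.2 + p.2 * Int.gcdB d.1 d.2, Prod.ext ?_ ?_⟩
  · simp only [Prod.smul_fst, smul_eq_mul]
    linear_combination (-p.1) * hb - Int.gcdB d.1 d.2 * h
  · simp only [Prod.smul_snd, smul_eq_mul]
    linear_combination (-p.2) * hb + Int.gcdA d.1 d.2 * h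

/-- A finite set of lattice points closed under passing to intermediate points
of arithmetic progressions. -/
def IsProgressionConvex (R : Finset (ℤ × ℤ)) : Prop :=
  ∀ (p w : ℤ × ℤ) (k l : ℕ), p - k • w ∈ R → p + l • w ∈ R → p ∈ R

theorem IsProgressionConvex.filter_add_mem {R : Finset (ℤ × ℤ)} (hR : IsProgressionConvex R)
    (v : ℤ × ℤ) : IsProgressionConvex (R.filter (fun p => p + v ∈ R)) := by
  intro p w k l h₁ h₂
  rw [Finset.mem_filter] at h₁ h₂ ⊢
  refine ⟨hR p w k l h₁.1 h₂.1, hR (p + v) w k l ?_ ?_⟩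
  · rw [add_sub_right_comm]; exact h₁.2
  · rw [add_right_comm]; exact h₂.2

theorem isProgressionConvex_rectangle (m n : ℕ) :
    IsProgressionConvex (Finset.Ico (0 : ℤ) m ×ˢ Finset.Ico (0 : ℤ) n) := by
  have key (N x w : ℤ) (k l : ℕ) (h₁ : 0 ≤ x - k * w ∧ x - k * w < N)
      (h₂ : 0 ≤ x + l * w ∧ x + l * w < N) : 0 ≤ x ∧ x < N := by
    rcases le_total 0 w with hw | hw
    · have h₃ : 0 ≤ (k : ℤ) * w := by positivity
      have h₄ : 0 ≤ (l : ℤ) * w := by positivity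
      constructor <;> linarith
    · have h₃ : (k : ℤ) * w ≤ 0 := mul_nonpos_of_nonneg_of_nonpos (by positivity) hw
      have h₄ : (l : ℤ) * w ≤ 0 := mul_nonpos_of_nonneg_of_nonpos (by positivity) hw
      constructor <;> linarith
  intro p w k l h₁ h₂
  simp only [Finset.mem_product, Finset.mem_Ico, Prod.fst_sub, Prod.snd_sub, Prod.fst_add,
    Prod.snd_add, nsmul_eq_mul] at h₁ h₂ ⊢
  exact ⟨key _ _ _ _ _ h₁.1 h₂.1, key _ _ _ _ _ h₁.2 h₂.2⟩

section

variable {G : Type*} [AddCommGroup G]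

theorem Finsupp.mapDomain_apply_eq_sum_filter {α β : Type*} [DecidableEq β] (φ : α → β)
    (h : α →₀ G) {R : Finset α} (hR : h.support ⊆ R) (t : β) :
    Finsupp.mapDomain φ h t = ∑ p ∈ R.filter (fun p => φ p = t), h p := by
  rw [Finsupp.mapDomain, Finsupp.sum_apply, Finsupp.sum_of_support_subset _ hR _ (by simp),
    Finset.sum_filter]
  exact Finset.sum_congr rfl fun p _ => Finsupp.single_apply

theorem Finsupp.mapDomain_add_right_apply {α : Type*} [AddGroup α] (v : α) (h : α →₀ G) (p : α) :
    Finsupp.mapDomain (· + v) h p = h (p - v) := by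
  conv_lhs => rw [← sub_add_cancel p v]
  exact Finsupp.mapDomain_apply (add_left_injective v) h (p - v)

theorem Finsupp.eq_zero_of_mapDomain_add_right_eq {L : ℤ →₀ G} {c : ℤ} (hc : c ≠ 0)
    (h : Finsupp.mapDomain (· + c) L = L) : L = 0 := by
  have hper (t : ℤ) : L (t + c) = L t := by
    conv_lhs => rw [← h, Finsupp.mapDomain_add_right_apply, add_sub_cancel_right]
  ext t
  by_contra ht
  have hmem (k : ℕ) : L (t + k * c) = L t := by
    induction k with
    | zero => simp
    | succ k ih => rw [← ih, ← hper (t + k * c)]; congr 1; push_cast; ring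
  refine Set.infinite_of_injective_forall_mem (s := (L.support : Set ℤ))
    (f := fun k : ℕ => t + k * c) (fun a b hab => ?_) (fun k => ?_) L.support.finite_toSet
  · simpa [hc] using hab
  · simpa [hmem k] using ht

/-- Translation by `v` minus the identity, on finitely supported functions. -/
noncomputable def translateSub (v : ℤ × ℤ) (q : ℤ × ℤ →₀ G) : ℤ × ℤ →₀ G :=
  Finsupp.mapDomain (· + v) q - q

theorem mapDomain_lineForm_translateSub (d v : ℤ × ℤ) (q : ℤ × ℤ →₀ G) :
    Finsupp.mapDomain (lineForm d) (translateSub v q) =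
      Finsupp.mapDomain (· + lineForm d v) (Finsupp.mapDomain (lineForm d) q) -
        Finsupp.mapDomain (lineForm d) q := by
  rw [translateSub, sub_eq_add_neg, sub_eq_add_neg, Finsupp.mapDomain_add,
    ← Finsupp.mapDomain_comp, ← Finsupp.mapDomain_comp]
  congr 1
  · congr 1
    ext p
    simp
  · exact map_neg (Finsupp.mapDomain.addMonoidHom (lineForm d)) q

theorem support_translateSub_subset {R : Finset (ℤ × ℤ)} {v : ℤ × ℤ} {q : ℤ × ℤ →₀ G}
    (hq : q.support ⊆ R.filter (fun p => p + v ∈ R)) : (translateSub v q).support ⊆ R := by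
  intro p hp
  by_contra hpR
  have hz (s : ℤ × ℤ) (hs : ¬ (s ∈ R ∧ s + v ∈ R)) : q s = 0 := by
    by_contra h
    exact hs (Finset.mem_filter.1 (hq (Finsupp.mem_support_iff.2 h)))
  rw [Finsupp.mem_support_iff, translateSub, Finsupp.sub_apply,
    Finsupp.mapDomain_add_right_apply, hz p (fun h => hpR h.1),
    hz (p - v) (fun h => hpR (by simpa using h.2))] at hp
  simp at hp

theorem exists_translateSub_eq {d : ℤ × ℤ} (hd : Int.gcd d.1 d.2 = 1) {R : Finset (ℤ × ℤ)}
    (hR : IsProgressionConvex R) {h : ℤ × ℤ →₀ G} (hsupp : h.support ⊆ R)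
    (hzero : Finsupp.mapDomain (lineForm d) h = 0) :
    ∃ q : ℤ × ℤ →₀ G, q.support ⊆ R.filter (fun p => p + d ∈ R) ∧ translateSub d q = h := by
  classical
  have hd0 : d ≠ 0 := by
    rintro rfl
    simp at hd
  let F (p : ℤ × ℤ) : Finset (ℤ × ℤ) :=
    h.support.filter (fun s => ∃ k : ℕ, s = p + (k + 1) • d)
  let q₀ (p : ℤ × ℤ) : G := ∑ s ∈ F p, h s
  have hq₀ (p : ℤ × ℤ) (hp : q₀ p ≠ 0) : p ∈ R.filter (fun p => p + d ∈ R) := by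
    obtain ⟨s, hs, -⟩ := Finset.exists_ne_zero_of_sum_ne_zero hp
    obtain ⟨hs, l, rfl⟩ := Finset.mem_filter.1 hs
    obtain ⟨k, hk⟩ : ∃ k : ℕ, p - k • d ∈ h.support := by
      by_contra! hno
      refine hp ?_
      have hsum := Finsupp.mapDomain_apply_eq_sum_filter (lineForm d) h (subset_refl _)
        (lineForm d p)
      rw [hzero, Finsupp.zero_apply] at hsum
      rw [hsum]
      refine Finset.sum_congr (Finset.filter_congr fun s hs => ⟨?_, fun h₁ => ?_⟩) fun _ _ => rfl
      · rintro ⟨k, rfl⟩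
        rw [map_add, map_nsmul, lineForm_self, smul_zero, add_zero]
      · obtain ⟨k, hk⟩ := exists_zsmul_of_lineForm_eq_zero (p := s - p) hd
          (by rw [map_sub, h₁, sub_self])
        rw [sub_eq_iff_eq_add'] at hk
        rcases lt_or_ge 0 k with hpos | hneg
        · obtain ⟨j, rfl⟩ : ∃ j : ℕ, k = ((j + 1 : ℕ) : ℤ) := ⟨(k - 1).toNat, by omega⟩
          exact ⟨j, by rw [hk, natCast_zsmul]⟩
        · obtain ⟨j, rfl⟩ : ∃ j : ℕ, k = -(j : ℤ) := ⟨(-k).toNat, by omega⟩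
          refine absurd hs ?_
          rw [hk, neg_smul, natCast_zsmul, ← sub_eq_add_neg]
          exact hno j
    refine Finset.mem_filter.2 ⟨hR p d k (l + 1) (hsupp hk) (hsupp hs),
      hR (p + d) d (k + 1) l ?_ ?_⟩
    · convert hsupp hk using 1
      rw [succ_nsmul]; abel
    · convert hsupp hs using 1
      rw [succ_nsmul]; abel
  refine ⟨Finsupp.onFinset _ q₀ hq₀, Finsupp.support_onFinset_subset, ?_⟩
  ext p
  rw [translateSub, Finsupp.sub_apply, Finsupp.mapDomain_add_right_apply,
    Finsupp.onFinset_apply, Finsupp.onFinset_apply, sub_eq_iff_eq_add]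
  have hp : p ∉ F p := by
    intro hmem
    obtain ⟨-, k, hk⟩ := Finset.mem_filter.1 hmem
    rw [left_eq_add, smul_eq_zero] at hk
    exact hk.elim (by omega) hd0
  have hF : F (p - d) ⊆ insert p (F p) := by
    intro s hs
    obtain ⟨hs, k, rfl⟩ := Finset.mem_filter.1 hs
    rcases k with _ | k
    · simp
    · refine Finset.mem_insert_of_mem (Finset.mem_filter.2 ⟨hs, k, ?_⟩)
      rw [succ_nsmul _ (k + 1)]; abel
  have hF' : ∀ s ∈ insert p (F p), s ∉ F (p - d) → h s = 0 := by
    intro s hs hns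
    by_contra hne
    refine hns (Finset.mem_filter.2 ⟨Finsupp.mem_support_iff.2 hne, ?_⟩)
    rcases Finset.mem_insert.1 hs with rfl | hs
    · exact ⟨0, by simp⟩
    · obtain ⟨-, k, rfl⟩ := Finset.mem_filter.1 hs
      exact ⟨k + 1, by rw [succ_nsmul _ (k + 1)]; abel⟩
  change ∑ s ∈ F (p - d), h s = h p + ∑ s ∈ F p, h s
  rw [Finset.sum_subset hF hF', Finset.sum_insert hp]

/-- Functions on a convex set with vanishing line sums lift along surjections of the
coefficient groups. -/
theorem exists_lift_of_mapDomain_lineForm_eq_zero {M : Type*} [AddCommGroup M] (π : M →+ G)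
    (hπ : Function.Surjective π) (S : Finset (ℤ × ℤ)) :
    (∀ d ∈ S, Int.gcd d.1 d.2 = 1) → ∀ (R : Finset (ℤ × ℤ)), IsProgressionConvex R →
    ∀ h : ℤ × ℤ →₀ G, h.support ⊆ R → (∀ d ∈ S, Finsupp.mapDomain (lineForm d) h = 0) →
    ∃ H : ℤ × ℤ →₀ M, H.support ⊆ R ∧ (∀ d ∈ S, Finsupp.mapDomain (lineForm d) H = 0) ∧
      ∀ p, π (H p) = h p := by
  classical
  induction S using Finset.induction_on with
  | empty =>
    intro _ R _ h hsupp _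
    choose σ hσ using hπ
    refine ⟨Finsupp.onFinset R (fun p => if h p = 0 then 0 else σ (h p)) fun p hp => ?_,
      Finsupp.support_onFinset_subset, by simp, fun p => ?_⟩
    · exact hsupp (Finsupp.mem_support_iff.2 fun h0 => hp (if_pos h0))
    · rw [Finsupp.onFinset_apply]
      split_ifs with h0
      · rw [h0, map_zero]
      · exact hσ _
  | insert d S _ ih =>
    intro hS R hR h hsupp hzero
    have hS' : ∀ d' ∈ S, Int.gcd d'.1 d'.2 = 1 := fun d' hd' => hS d' (Finset.mem_insert_of_mem hd')
    have hzero' : ∀ d' ∈ S, Finsupp.mapDomain (lineForm d') h = 0 :=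
      fun d' hd' => hzero d' (Finset.mem_insert_of_mem hd')
    by_cases hpar : ∃ d' ∈ S, lineForm d' d = 0
    · obtain ⟨d', hd', hdd'⟩ := hpar
      obtain ⟨H, hHR, hHS, hHh⟩ := ih hS' R hR h hsupp hzero'
      refine ⟨H, hHR, Finset.forall_mem_insert _ _ _ |>.2 ⟨?_, hHS⟩, hHh⟩
      obtain ⟨k, rfl⟩ := exists_zsmul_of_lineForm_eq_zero (hS' d' hd') hdd'
      have hcomp : (lineForm (k • d') : ℤ × ℤ → ℤ) = (k * ·) ∘ lineForm d' := by
        ext p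
        simp only [lineForm_apply, Function.comp_apply, Prod.smul_fst, Prod.smul_snd, smul_eq_mul]
        ring
      rw [hcomp, Finsupp.mapDomain_comp, hHS d' hd', Finsupp.mapDomain_zero]
    · push Not at hpar
      obtain ⟨q, hqR, rfl⟩ := exists_translateSub_eq (hS d (Finset.mem_insert_self _ _)) hR hsupp
        (hzero d (Finset.mem_insert_self _ _))
      obtain ⟨Q, hQR, hQS, hQq⟩ := ih hS' _ (hR.filter_add_mem d) q hqR fun d' hd' => by
        refine Finsupp.eq_zero_of_mapDomain_add_right_eq (hpar d' hd') (sub_eq_zero.1 ?_)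
        rw [← mapDomain_lineForm_translateSub]
        exact hzero' d' hd'
      refine ⟨translateSub d Q, support_translateSub_subset hQR,
        Finset.forall_mem_insert _ _ _ |>.2 ⟨?_, fun d' hd' => ?_⟩, fun p => ?_⟩
      · simp [mapDomain_lineForm_translateSub, lineForm_self, ← Function.id_def]
      · simp [mapDomain_lineForm_translateSub, hQS d' hd']
      · simp [translateSub, Finsupp.mapDomain_add_right_apply, hQq]

end

theorem lineSum_eq_mapDomain (m n : ℕ) (H : ℤ × ℤ →₀ ℝ)
    (hH : H.support ⊆ Finset.Ico (0 : ℤ) m ×ˢ Finset.Ico (0 : ℤ) n) (d : ℤ × ℤ) (t : ℤ) :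
    lineSum m n (fun p => H ((p.1 : ℤ), (p.2 : ℤ))) d t =
      Finsupp.mapDomain (lineForm d) H t := by
  rw [Finsupp.mapDomain_apply_eq_sum_filter _ _ hH, lineSum]
  refine Finset.sum_bij (fun p _ => ((p.1 : ℤ), (p.2 : ℤ))) ?_ ?_ ?_ ?_
  · intro p hp
    have hp := (Finset.mem_filter.1 hp).2
    refine Finset.mem_filter.2 ⟨by simp, ?_⟩
    rw [lineForm_apply]
    linarith
  · intro p _ q _ hpq
    simp only [Prod.mk.injEq] at hpq
    ext <;> omega
  · rintro ⟨i, j⟩ hp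
    obtain ⟨hp, ht⟩ := Finset.mem_filter.1 hp
    rw [Finset.mem_product, Finset.mem_Ico, Finset.mem_Ico] at hp
    obtain ⟨⟨hi, him⟩, hj, hjn⟩ := hp
    lift i to ℕ using hi
    lift j to ℕ using hj
    refine ⟨(⟨i, by simpa using him⟩, ⟨j, by simpa using hjn⟩),
      Finset.mem_filter.2 ⟨Finset.mem_univ _, ?_⟩, rfl⟩
    rw [lineForm_apply] at ht
    linarith
  · intro _ _
    rfl

/-- Lemma 2.3 (Stolk): if all line sums of a real function `g` with respect to a valid
set `S` of directions are integers, then there exists an integer-valued function with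
the same line sums. -/
theorem stmt_12 (m n : ℕ) (hm : 0 < m) (hn : 0 < n)
    (S : Finset (ℤ × ℤ)) (hS : S.Nonempty) (hSdir : ∀ d ∈ S, IsDirection d)
    (hMm : (∑ d ∈ S, d.1) < (m : ℤ)) (hNn : (∑ d ∈ S, |d.2|) < (n : ℤ))
    (g : Fin m × Fin n → ℝ)
    (hint : ∀ d ∈ S, ∀ t : ℤ, ∃ z : ℤ, lineSum m n g d t = (z : ℝ)) :
    ∃ f : Fin m × Fin n → ℤ,
      ∀ d ∈ S, ∀ t : ℤ,
        lineSum m n (fun p => (f p : ℝ)) d t = lineSum m n g d t := by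
  classical
  let R := Finset.Ico (0 : ℤ) m ×ˢ Finset.Ico (0 : ℤ) n
  let π : ℝ →+ ℝ ⧸ AddSubgroup.zmultiples (1 : ℝ) := QuotientAddGroup.mk' _
  have hπ (x : ℝ) : π x = 0 ↔ ∃ z : ℤ, x = z := by
    rw [QuotientAddGroup.mk'_apply, QuotientAddGroup.eq_zero_iff, AddSubgroup.mem_zmultiples_iff]
    simp [eq_comm]
  obtain ⟨K, hKR, hKg⟩ : ∃ K : ℤ × ℤ →₀ ℝ, K.support ⊆ R ∧
      ∀ p : Fin m × Fin n, K ((p.1 : ℤ), (p.2 : ℤ)) = g p := by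
    refine ⟨Finsupp.onFinset R (fun p =>
      if hp : 0 ≤ p.1 ∧ p.1 < m ∧ 0 ≤ p.2 ∧ p.2 < n then
        g (⟨p.1.toNat, by omega⟩, ⟨p.2.toNat, by omega⟩) else 0) fun p hp => ?_,
      Finsupp.support_onFinset_subset, fun p => ?_⟩
    · by_contra hpR
      refine hp (dif_neg fun h => hpR ?_)
      simp only [R, Finset.mem_product, Finset.mem_Ico]
      omega
    · rw [Finsupp.onFinset_apply, dif_pos (by simp)]
      simp
  have hK (d : ℤ × ℤ) (t : ℤ) : lineSum m n g d t = Finsupp.mapDomain (lineForm d) K t := by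
    rw [← lineSum_eq_mapDomain m n K hKR]
    simp only [hKg]
  obtain ⟨H, hHR, hHS, hHK⟩ := exists_lift_of_mapDomain_lineForm_eq_zero π
    (QuotientAddGroup.mk'_surjective _) S (fun d hd => (hSdir d hd).1) R
    (isProgressionConvex_rectangle m n) (Finsupp.mapRange.addMonoidHom π K)
    ((Finsupp.support_mapRange (hf := map_zero π)).trans hKR) (fun d hd => by
      ext t
      rw [Finsupp.mapRange.addMonoidHom_apply,
        Finsupp.mapDomain_mapRange _ _ _ (map_zero π) (map_add π), Finsupp.mapRange_apply, ← hK]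
      exact (hπ _).2 (hint d hd t))
  have hf (p : Fin m × Fin n) : ∃ z : ℤ, g p - H ((p.1 : ℤ), (p.2 : ℤ)) = z := by
    rw [← hπ, map_sub, hHK, ← hKg]
    simp
  choose f hf using hf
  refine ⟨f, fun d hd t => ?_⟩
  simp only [← hf]
  rw [lineSum_sub, lineSum_eq_mapDomain m n H hHR, hHS d hd]
  simp
end

section
/- Let n be a positive integer and let a, b, i, j, x, y be integers with gcd(a,b) = 1. Then bx − ay ≡ bi − aj (mod n) if and only if there exist integers i_0, j_0 with i_0 ≡ x (mod n), j_0 ≡ y (mod n) and b·i_0 − a·j_0 = b·i − a·j. -/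
/-- Lemma 6.1: for coprime `a, b`, one has `bx − ay ≡ bi − aj (mod n)` iff there exist
integers `i₀ ≡ x (mod n)` and `j₀ ≡ y (mod n)` with `b·i₀ − a·j₀ = b·i − a·j`. -/
theorem stmt_13 (n : ℕ) (hn : 0 < n) (a b i j x y : ℤ) (hab : Int.gcd a b = 1) :
    Int.ModEq (n : ℤ) (b * x - a * y) (b * i - a * j) ↔
      ∃ i0 j0 : ℤ, Int.ModEq (n : ℤ) i0 x ∧ Int.ModEq (n : ℤ) j0 y ∧
        b * i0 - a * j0 = b * i - a * j := by
  constructor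
  · intro h
    obtain ⟨k, hk⟩ := h.dvd
    obtain ⟨u, v, huv⟩ := Int.isCoprime_iff_gcd_eq_one.mpr hab
    refine ⟨x + n * (k * v), y - n * (k * u), ?_, ?_, ?_⟩
    · exact (Int.modEq_iff_dvd.mpr ⟨k * v, by ring⟩ : x ≡ x + n * (k * v) [ZMOD n]).symm
    · exact Int.modEq_iff_dvd.mpr ⟨k * u, by ring⟩
    · linear_combination (n * k : ℤ) * huv - hk
  · rintro ⟨i0, j0, hi, hj, h⟩
    rw [← h]
    exact (hi.symm.mul_left b).sub (hj.symm.mul_left a)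
end

section
/- Let S = {(a_1,b_1),…,(a_k,b_k)} be a set of pairwise independent admissible directions for A = (ℤ/nℤ)² and let g : A → ℝ. Define f_0 : A → ℝ by f_0(p) = Σ_{d=1}^k L_g((a_d,b_d),p)/n − (k−1)·T_g/n². Then: (i) f_0 has the same torus line sums as g along every direction of S, i.e. L_{f_0}((a_d,b_d),p) = L_g((a_d,b_d),p) for all d and all p ∈ A; (ii) Σ_{p∈A} f_0(p)h(p) = 0 for every h : A → ℝ all of whose torus line sums along directions of S vanish; consequently f_0 is the element of minimal Euclidean norm among all f : A → ℝ having the same torus line sums as g along all directions of S. -/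
/-- The torus line sum of `g : (ℤ/nℤ)² → ℝ` in direction `d = (a,b)` through the
point `p`. -/
noncomputable def torusLineSum (n : ℕ) [NeZero n] (g : ZMod n × ZMod n → ℝ)
    (d : ℤ × ℤ) (p : ZMod n × ZMod n) : ℝ :=
  ∑ q ∈ Finset.univ.filter (fun q : ZMod n × ZMod n =>
      (d.2 : ZMod n) * q.1 - (d.1 : ZMod n) * q.2 =
        (d.2 : ZMod n) * p.1 - (d.1 : ZMod n) * p.2), g q

/-- Over a finite commutative ring, a pair of linear forms with unit determinant is bijective. -/
theorem bijective_linearForms_of_isUnit_det {R : Type*} [CommRing R] [Finite R] {x y z w : R}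
    (h : IsUnit (x * w - y * z)) :
    Function.Bijective (fun q : R × R => (x * q.1 - y * q.2, z * q.1 - w * q.2)) := by
  refine Finite.injective_iff_bijective.mp ?_
  rintro ⟨p₁, p₂⟩ ⟨q₁, q₂⟩ hpq
  obtain ⟨h₁, h₂⟩ := Prod.mk.inj hpq
  dsimp only at h₁ h₂
  refine Prod.ext (h.mul_left_cancel ?_) (h.mul_left_cancel ?_)
  · linear_combination w * h₁ - y * h₂
  · linear_combination z * h₁ - x * h₂

section TorusLineSum

variable (n : ℕ) [NeZero n]

theorem torusLineSum_congr (g : ZMod n × ZMod n → ℝ) (d : ℤ × ℤ) {p q : ZMod n × ZMod n}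
    (h : (d.2 : ZMod n) * q.1 - (d.1 : ZMod n) * q.2 =
      (d.2 : ZMod n) * p.1 - (d.1 : ZMod n) * p.2) :
    torusLineSum n g d q = torusLineSum n g d p := by
  simp only [torusLineSum, h]

theorem torusLineSum_const {d : ℤ × ℤ} (hd : Int.gcd d.1 d.2 = 1) (c : ℝ)
    (p : ZMod n × ZMod n) : torusLineSum n (fun _ => c) d p = n * c := by
  obtain ⟨u, v, huv⟩ := Int.isCoprime_iff_gcd_eq_one.mpr hd
  have huv' : (u : ZMod n) * d.1 + v * d.2 = 1 := by
    exact_mod_cast congrArg (Int.cast (R := ZMod n)) huv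
  have hu : IsUnit ((d.2 : ZMod n) * v - d.1 * -u) := by
    convert isUnit_one using 1
    linear_combination huv'
  have key := (bijective_linearForms_of_isUnit_det hu).sum_comp
    (fun s : ZMod n × ZMod n =>
      if s.1 = (d.2 : ZMod n) * p.1 - (d.1 : ZMod n) * p.2 then c else 0)
  rw [torusLineSum, Finset.sum_filter, key, Fintype.sum_prod_type_right]
  simp [ZMod.card]

theorem torusLineSum_torusLineSum_self {d : ℤ × ℤ} (hd : Int.gcd d.1 d.2 = 1)
    (g : ZMod n × ZMod n → ℝ) (p : ZMod n × ZMod n) :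
    torusLineSum n (torusLineSum n g d) d p = n * torusLineSum n g d p := by
  rw [← torusLineSum_const n hd _ p]
  refine Finset.sum_congr rfl fun q hq => ?_
  exact torusLineSum_congr n g d (Finset.mem_filter.mp hq).2

theorem torusLineSum_torusLineSum_of_indep {d d' : ℤ × ℤ}
    (h : Int.gcd (d.1 * d'.2 - d.2 * d'.1) (n : ℤ) = 1)
    (g : ZMod n × ZMod n → ℝ) (p : ZMod n × ZMod n) :
    torusLineSum n (torusLineSum n g d') d p = ∑ q, g q := by
  have hu : IsUnit ((d.2 : ZMod n) * d'.1 - d.1 * d'.2) := by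
    obtain ⟨u, v, huv⟩ := Int.isCoprime_iff_gcd_eq_one.mpr h
    have huv' := congrArg (Int.cast (R := ZMod n)) huv
    push_cast at huv'
    rw [ZMod.natCast_self] at huv'
    refine IsUnit.of_mul_eq_one (-u : ZMod n) ?_
    linear_combination huv'
  have key := (bijective_linearForms_of_isUnit_det hu).sum_comp
    (fun s : ZMod n × ZMod n =>
      if s.1 = (d.2 : ZMod n) * p.1 - (d.1 : ZMod n) * p.2 then
        ∑ r : ZMod n × ZMod n,
          if (d'.2 : ZMod n) * r.1 - (d'.1 : ZMod n) * r.2 = s.2 then g r else 0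
      else 0)
  simp only [torusLineSum, Finset.sum_filter]
  rw [key, Fintype.sum_prod_type_right]
  simp only [Finset.sum_ite_eq', Finset.mem_univ, if_true]
  rw [Finset.sum_comm]
  simp

theorem sum_torusLineSum_mul (g h : ZMod n × ZMod n → ℝ) (d : ℤ × ℤ) :
    ∑ p, torusLineSum n g d p * h p = ∑ p, g p * torusLineSum n h d p := by
  simp only [torusLineSum, Finset.sum_filter, Finset.sum_mul, Finset.mul_sum]
  rw [Finset.sum_comm]
  refine Finset.sum_congr rfl fun q _ => Finset.sum_congr rfl fun p _ => ?_
  simp only [ite_mul, mul_ite, zero_mul, mul_zero, eq_comm]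

end TorusLineSum

/-- Theorem 6.5: for a set `S` of pairwise independent admissible directions on the
torus `(ℤ/nℤ)²` and `g : (ℤ/nℤ)² → ℝ`, the function
`f₀(p) = Σ_{d∈S} L_g(d,p)/n − (k−1)·T_g/n²` has the same torus line sums as `g`, is
orthogonal to every function with vanishing torus line sums, and is the shortest
solution. -/
theorem stmt_17 (n : ℕ) [NeZero n]
    (S : Finset (ℤ × ℤ)) (hS : S.Nonempty)
    (hadm : ∀ d ∈ S, Int.gcd d.1 d.2 = 1)
    (hindep : ∀ d ∈ S, ∀ d' ∈ S, d ≠ d' →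
      Int.gcd (d.1 * d'.2 - d.2 * d'.1) (n : ℤ) = 1)
    (g : ZMod n × ZMod n → ℝ)
    (f0 : ZMod n × ZMod n → ℝ)
    (hf0 : ∀ p : ZMod n × ZMod n,
      f0 p = (∑ d ∈ S, torusLineSum n g d p) / (n : ℝ) -
        ((S.card : ℝ) - 1) * (∑ q : ZMod n × ZMod n, g q) / (n : ℝ) ^ 2) :
    (∀ d ∈ S, ∀ p : ZMod n × ZMod n,
      torusLineSum n f0 d p = torusLineSum n g d p) ∧
    (∀ h : ZMod n × ZMod n → ℝ,
      (∀ d ∈ S, ∀ p : ZMod n × ZMod n, torusLineSum n h d p = 0) →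
      ∑ p : ZMod n × ZMod n, f0 p * h p = 0) ∧
    (∀ f : ZMod n × ZMod n → ℝ,
      (∀ d ∈ S, ∀ p : ZMod n × ZMod n,
        torusLineSum n f d p = torusLineSum n g d p) →
      ∑ p : ZMod n × ZMod n, (f0 p) ^ 2 ≤ ∑ p : ZMod n × ZMod n, (f p) ^ 2) := by
  have hn : (n : ℝ) ≠ 0 := Nat.cast_ne_zero.mpr (NeZero.ne n)
  have sums_eq : ∀ d ∈ S, ∀ p, torusLineSum n f0 d p = torusLineSum n g d p := by
    intro d hd p
    have expand : torusLineSum n f0 d p =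
        (∑ d' ∈ S, torusLineSum n (torusLineSum n g d') d p) / n -
          torusLineSum n (fun _ => ((S.card : ℝ) - 1) * (∑ q, g q) / (n : ℝ) ^ 2) d p := by
      unfold torusLineSum at hf0 ⊢
      rw [Finset.sum_comm, Finset.sum_div, ← Finset.sum_sub_distrib]
      exact Finset.sum_congr rfl fun q _ => hf0 q
    have others : ∑ d' ∈ S.erase d, torusLineSum n (torusLineSum n g d') d p =
        ((S.card : ℝ) - 1) * ∑ q, g q := by
      rw [Finset.sum_congr rfl fun d' hd' => torusLineSum_torusLineSum_of_indep n
        (hindep d hd d' (Finset.mem_of_mem_erase hd') (Finset.ne_of_mem_erase hd').symm) g p,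
        Finset.sum_const, nsmul_eq_mul, Finset.cast_card_erase_of_mem hd]
    rw [expand, ← Finset.add_sum_erase S _ hd, others,
      torusLineSum_torusLineSum_self n (hadm d hd), torusLineSum_const n (hadm d hd)]
    field_simp
    ring
  have orthogonal : ∀ h : ZMod n × ZMod n → ℝ,
      (∀ d ∈ S, ∀ p, torusLineSum n h d p = 0) → ∑ p, f0 p * h p = 0 := by
    intro h hh
    have sum_zero : ∑ p, h p = 0 := by
      obtain ⟨d, hd⟩ := hS
      have := sum_torusLineSum_mul n (fun _ => 1) h d
      simp only [torusLineSum_const n (hadm d hd), hh d hd, mul_zero, mul_one,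
        Finset.sum_const_zero, ← Finset.mul_sum] at this
      exact (mul_eq_zero.mp this).resolve_left hn
    have lines_zero : ∑ p, (∑ d ∈ S, torusLineSum n g d p) * h p = 0 := by
      simp only [Finset.sum_mul]
      rw [Finset.sum_comm]
      refine Finset.sum_eq_zero fun d hd => ?_
      simp [sum_torusLineSum_mul, hh d hd]
    simp only [hf0, sub_mul, Finset.sum_sub_distrib, div_mul_eq_mul_div _ _ (h _),
      ← Finset.sum_div, ← Finset.mul_sum, lines_zero, sum_zero, mul_zero, zero_div, sub_zero]
  refine ⟨sums_eq, orthogonal, fun f hf => ?_⟩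
  have cross := orthogonal (fun p => f p - f0 p) fun d hd p => by
    have := (hf d hd p).trans (sums_eq d hd p).symm
    unfold torusLineSum at this ⊢
    rw [Finset.sum_sub_distrib, this, sub_self]
  have pythagoras : ∑ p, f p ^ 2 =
      ∑ p, f0 p ^ 2 + 2 * ∑ p, f0 p * (f p - f0 p) + ∑ p, (f p - f0 p) ^ 2 := by
    rw [Finset.mul_sum, ← Finset.sum_add_distrib, ← Finset.sum_add_distrib]
    exact Finset.sum_congr rfl fun p _ => by ring
  have nonneg : 0 ≤ ∑ p, (f p - f0 p) ^ 2 := Finset.sum_nonneg fun p _ => sq_nonneg _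
  rw [pythagoras, cross]
  linarith
end

section
/- The function f_0(x,y) = c(x)/n + r(y)/m − λ(A)/(mn) is the shortest element in L² norm among all bounded measurable functions with the same row and column integrals as 1_A: for every bounded Lebesgue measurable g : T → ℝ such that ∫₀ⁿ g(x,y) dy = c(x) for almost every x ∈ [0,m] and ∫₀^m g(x,y) dx = r(y) for almost every y ∈ [0,n], one has ∫∫_T g(x,y)² dx dy ≥ ∫∫_T f_0(x,y)² dx dy. -/
open MeasureTheory

/-- If `f` is orthogonal to `g - f`, then `∫ f ^ 2 ≤ ∫ g ^ 2`. -/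
theorem integral_sq_le_of_integral_mul_sub_eq_zero {α : Type*} [MeasurableSpace α]
    {μ : Measure α} {f g : α → ℝ} (hf : MemLp f 2 μ) (hg : MemLp g 2 μ)
    (h : ∫ x, f x * (g x - f x) ∂μ = 0) :
    ∫ x, f x ^ 2 ∂μ ≤ ∫ x, g x ^ 2 ∂μ := by
  have hfg : Integrable (fun x => f x * (g x - f x)) μ := hf.integrable_mul (hg.sub hf)
  have hle : ∫ x, (f x ^ 2 + 2 * (f x * (g x - f x))) ∂μ ≤ ∫ x, g x ^ 2 ∂μ :=
    integral_mono (hf.integrable_sq.add (hfg.const_mul 2)) hg.integrable_sq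
      fun x => by nlinarith [sq_nonneg (g x - f x)]
  rwa [integral_add hf.integrable_sq (hfg.const_mul 2), integral_const_mul, h, mul_zero,
    add_zero] at hle

section Prod

variable {α β : Type*} [MeasurableSpace α] [MeasurableSpace β] {μ : Measure α} {ν : Measure β}

/-- A function with vanishing sections is orthogonal to functions of the first variable. -/
theorem integral_prod_fst_mul_eq_zero [SFinite μ] [SFinite ν] {u : α → ℝ} {d : α × β → ℝ}
    (hint : Integrable (fun p => u p.1 * d p) (μ.prod ν))
    (hd : ∀ᵐ x ∂μ, ∫ y, d (x, y) ∂ν = 0) :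
    ∫ p, u p.1 * d p ∂(μ.prod ν) = 0 := by
  rw [integral_prod _ hint]
  refine integral_eq_zero_of_ae ?_
  filter_upwards [hd] with x hx
  simp [integral_const_mul, hx]

/-- A function with vanishing sections is orthogonal to functions of the second variable. -/
theorem integral_prod_snd_mul_eq_zero [SFinite μ] [SFinite ν] {v : β → ℝ} {d : α × β → ℝ}
    (hint : Integrable (fun p => v p.2 * d p) (μ.prod ν))
    (hd : ∀ᵐ y ∂ν, ∫ x, d (x, y) ∂μ = 0) :
    ∫ p, v p.2 * d p ∂(μ.prod ν) = 0 := by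
  rw [integral_prod_symm _ hint]
  refine integral_eq_zero_of_ae ?_
  filter_upwards [hd] with y hy
  simp [integral_const_mul, hy]

/-- Among square-integrable functions on a product of finite measure spaces with given marginals,
one of the form `u x + v y` has the least `L²` norm. -/
theorem integral_add_sq_le_of_marginals_eq [IsFiniteMeasure μ] [IsFiniteMeasure ν]
    {u : α → ℝ} {v : β → ℝ} {g : α × β → ℝ}
    (hu : MemLp u 2 μ) (hv : MemLp v 2 ν) (hg : MemLp g 2 (μ.prod ν))
    (h₁ : ∀ᵐ x ∂μ, ∫ y, g (x, y) ∂ν = ∫ y, (u x + v y) ∂ν)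
    (h₂ : ∀ᵐ y ∂ν, ∫ x, g (x, y) ∂μ = ∫ x, (u x + v y) ∂μ) :
    ∫ p, (u p.1 + v p.2) ^ 2 ∂(μ.prod ν) ≤ ∫ p, g p ^ 2 ∂(μ.prod ν) := by
  have hu' : MemLp (fun p : α × β => u p.1) 2 (μ.prod ν) := hu.comp_fst ν
  have hv' : MemLp (fun p : α × β => v p.2) 2 (μ.prod ν) := hv.comp_snd μ
  have hf : MemLp (fun p : α × β => u p.1 + v p.2) 2 (μ.prod ν) := hu'.add hv'
  have hd : MemLp (fun p : α × β => g p - (u p.1 + v p.2)) 2 (μ.prod ν) := hg.sub hf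
  have hgi : Integrable g (μ.prod ν) := hg.integrable one_le_two
  have hui : Integrable u μ := hu.integrable one_le_two
  have hvi : Integrable v ν := hv.integrable one_le_two
  refine integral_sq_le_of_integral_mul_sub_eq_zero hf hg ?_
  have hud : Integrable (fun p : α × β => u p.1 * (g p - (u p.1 + v p.2))) (μ.prod ν) :=
    hu'.integrable_mul hd
  have hvd : Integrable (fun p : α × β => v p.2 * (g p - (u p.1 + v p.2))) (μ.prod ν) :=
    hv'.integrable_mul hd
  simp only [add_mul]
  rw [integral_add hud hvd, integral_prod_fst_mul_eq_zero hud, integral_prod_snd_mul_eq_zero hvd,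
    add_zero]
  · filter_upwards [h₂, hgi.prod_left_ae] with y hy hyi
    have hsum : Integrable (fun x => u x + v y) μ := hui.add (integrable_const _)
    rw [integral_sub hyi hsum, hy, sub_self]
  · filter_upwards [h₁, hgi.prod_right_ae] with x hx hxi
    have hsum : Integrable (fun y => u x + v y) ν := (integrable_const _).add hvi
    rw [integral_sub hxi hsum, hx, sub_self]

end Prod

/-- Theorem 7.1 (minimality): `f₀(x,y) = c(x)/n + r(y)/m − λ(A)/(mn)` is the shortest
element in `L²` norm among all bounded measurable functions on `T = [0,m] × [0,n]`
having the same row and column integrals as the indicator function of `A`. -/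
theorem stmt_19 (m n : ℝ) (hm : 0 < m) (hn : 0 < n)
    (A : Set (ℝ × ℝ)) (hA : MeasurableSet A)
    (hAT : A ⊆ Set.Icc (0 : ℝ) m ×ˢ Set.Icc (0 : ℝ) n)
    (c r : ℝ → ℝ)
    (hc : ∀ x : ℝ, c x = ∫ y in (0 : ℝ)..n, A.indicator (fun _ => (1 : ℝ)) (x, y))
    (hr : ∀ y : ℝ, r y = ∫ x in (0 : ℝ)..m, A.indicator (fun _ => (1 : ℝ)) (x, y))
    (f0 : ℝ × ℝ → ℝ)
    (hf0 : ∀ p : ℝ × ℝ,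
      f0 p = c p.1 / n + r p.2 / m - (volume A).toReal / (m * n)) :
    ∀ g : ℝ × ℝ → ℝ, Measurable g → (∃ C : ℝ, ∀ p : ℝ × ℝ, |g p| ≤ C) →
      (∀ᵐ x ∂(volume.restrict (Set.Icc (0 : ℝ) m)),
        ∫ y in (0 : ℝ)..n, g (x, y) = c x) →
      (∀ᵐ y ∂(volume.restrict (Set.Icc (0 : ℝ) n)),
        ∫ x in (0 : ℝ)..m, g (x, y) = r y) →
      ∫ p in Set.Icc (0 : ℝ) m ×ˢ Set.Icc (0 : ℝ) n, (f0 p) ^ 2 ≤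
        ∫ p in Set.Icc (0 : ℝ) m ×ˢ Set.Icc (0 : ℝ) n, (g p) ^ 2 := by
  intro g hg hgC hgc hgr
  obtain ⟨C, hC⟩ := hgC
  set μ : Measure ℝ := volume.restrict (Set.Icc 0 m) with hμ
  set ν : Measure ℝ := volume.restrict (Set.Icc 0 n) with hν
  have integral_μ (φ : ℝ → ℝ) : ∫ x in (0 : ℝ)..m, φ x = ∫ x, φ x ∂μ := by
    rw [intervalIntegral.integral_of_le hm.le, hμ, integral_Icc_eq_integral_Ioc]
  have integral_ν (φ : ℝ → ℝ) : ∫ y in (0 : ℝ)..n, φ y = ∫ y, φ y ∂ν := by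
    rw [intervalIntegral.integral_of_le hn.le, hν, integral_Icc_eq_integral_Ioc]
  have hprod : volume.restrict (Set.Icc (0 : ℝ) m ×ˢ Set.Icc (0 : ℝ) n) = μ.prod ν := by
    rw [hμ, hν, Measure.prod_restrict, Measure.volume_eq_prod]
  have hμuniv : μ.real Set.univ = m := by simp [hμ, measureReal_def, hm.le]
  have hνuniv : ν.real Set.univ = n := by simp [hν, measureReal_def, hn.le]
  set χ : ℝ × ℝ → ℝ := A.indicator fun _ => 1 with hχ
  have hχm : StronglyMeasurable χ := stronglyMeasurable_const.indicator hA
  have hχb (p : ℝ × ℝ) : ‖χ p‖ ≤ 1 := by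
    simpa using norm_indicator_le_norm_self (fun _ : ℝ × ℝ => (1 : ℝ)) p
  have hχi : Integrable χ (μ.prod ν) :=
    .of_bound hχm.aestronglyMeasurable 1 (.of_forall hχb)
  have hχint : ∫ p, χ p ∂(μ.prod ν) = (volume A).toReal := by
    rw [hχ, integral_indicator_const _ hA, ← hprod, measureReal_restrict_apply hA,
      Set.inter_eq_left.mpr hAT, smul_eq_mul, mul_one, measureReal_def]
  have hc' : c = fun x => ∫ y, χ (x, y) ∂ν := funext fun x => by rw [hc, integral_ν]
  have hr' : r = fun y => ∫ x, χ (x, y) ∂μ := funext fun y => by rw [hr, integral_μ]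
  have hcL : MemLp c 2 μ := by
    rw [hc']
    exact .of_bound hχm.integral_prod_right'.aestronglyMeasurable _
      (.of_forall fun x => norm_integral_le_of_norm_le_const (.of_forall fun y => hχb _))
  have hrL : MemLp r 2 ν := by
    rw [hr']
    exact .of_bound hχm.integral_prod_left'.aestronglyMeasurable _
      (.of_forall fun y => norm_integral_le_of_norm_le_const (.of_forall fun x => hχb _))
  have hcint : ∫ x, c x ∂μ = (volume A).toReal := by
    rw [hc', ← hχint, integral_prod _ hχi]
  have hrint : ∫ y, r y ∂ν = (volume A).toReal := by
    rw [hr', ← hχint, integral_prod_symm _ hχi]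
  set L := (volume A).toReal
  have hcn : MemLp (fun x => c x / n - L / (m * n)) 2 μ := by
    simp only [div_eq_inv_mul]
    exact (hcL.const_mul n⁻¹).sub (memLp_const ((m * n)⁻¹ * L))
  have hrm : MemLp (fun y => r y / m) 2 ν := by
    simpa only [div_eq_inv_mul] using hrL.const_mul m⁻¹
  have hf0' : f0 = fun p => (c p.1 / n - L / (m * n)) + r p.2 / m := by
    funext p
    rw [hf0]
    ring
  rw [hprod, hf0']
  refine integral_add_sq_le_of_marginals_eq (u := fun x => c x / n - L / (m * n))
    (v := fun y => r y / m) hcn hrm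
    (.of_bound hg.aestronglyMeasurable C (.of_forall hC)) ?_ ?_
  · filter_upwards [hgc] with x hx
    rw [← integral_ν, hx, integral_add (integrable_const _) (hrm.integrable one_le_two),
      integral_const, integral_div, hrint, hνuniv, smul_eq_mul]
    field_simp
    ring
  · filter_upwards [hgr] with y hy
    rw [← integral_μ, hy, integral_add (hcn.integrable one_le_two) (integrable_const _),
      integral_sub ((hcL.integrable one_le_two).div_const n) (integrable_const _),
      integral_const, integral_const, integral_div, hcint, hμuniv, smul_eq_mul, smul_eq_mul]
    field_simp
    ring
end
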